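/- arXiv:2010.06650 — 2 statements merged into one kernel-verified Lean document; each statement's English description precedes it below -/
import Mathlib

section
/- Let A be a C*-algebra, p₁, …, pₙ a compatible chain of self-adjoint idempotents in A with the convention pₙ₊₁ = 0, H a group, and (H₁ ≤ … ≤ Hₙ, β₁, …, βₙ) a compatible system of homomorphisms for p₁, …, pₙ. Then for every 1 ≤ k ≤ n and every h ∈ H_k, the telescoping identity ∑_{i=k}^{n} (pᵢ − pᵢ₊₁) * βᵢ(h) * (pᵢ − pᵢ₊₁) = β_k(h) holds in A. -/
/-- For `p` a self-adjoint idempotent, `Dset p = {x | star x * x = p ∧ x * star x = p}`. -/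
def Dset {A : Type*} [Mul A] [Star A] (p : A) : Set A :=
  {x | star x * x = p ∧ x * star x = p}

theorem mul_eq_self_of_mem_Dset {A : Type*} [NormedRing A] [StarRing A] [CStarRing A] {p x : A}
    (hs : star p = p) (hp : p * p = p) (hx : x ∈ Dset p) : p * x = x := by
  rw [← sub_eq_zero, ← CStarRing.mul_star_self_eq_zero_iff]
  calc (p * x - x) * star (p * x - x)
      = p * (x * star x) * p - p * (x * star x) - x * star x * p + x * star x := by
        rw [star_sub, star_mul, hs]
        noncomm_ring
    _ = 0 := by simp [hx.2, hp]

theorem mul_eq_self_of_mem_Dset' {A : Type*} [NormedRing A] [StarRing A] [CStarRing A] {p x : A}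
    (hs : star p = p) (hp : p * p = p) (hx : x ∈ Dset p) : x * p = x := by
  have hx' : star x ∈ Dset p := ⟨by simpa using hx.2, by simpa using hx.1⟩
  simpa [hs] using congrArg star (mul_eq_self_of_mem_Dset hs hp hx')

theorem sub_mul_mul_sub_eq {A : Type*} [Ring A] {p q x : A} (hpx : p * x = x) (hxp : x * p = x)
    (hq : q * q = q) (hqx : q * x = x * q) : (p - q) * x * (p - q) = x - q * x := by
  calc (p - q) * x * (p - q) = (x - x * q) * (p - q) := by rw [sub_mul p q x, hpx, hqx]
    _ = x * p - x * q - (q * (x * p) - x * (q * q)) := by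
        rw [sub_mul, mul_sub, mul_sub, ← mul_assoc q, hqx, mul_assoc x q q]
    _ = x - q * x := by rw [hxp, hq, hqx, sub_self, sub_zero]

/-- The telescoping identity
`∑_{i=k}^{n} (pᵢ − pᵢ₊₁) * βᵢ(h) * (pᵢ − pᵢ₊₁) = β_k(h)` for a compatible system of
homomorphisms for a compatible chain `p 1, …, p n` (with the convention `p (n+1) = 0`). -/
theorem stmt12 {A : Type*} [NormedRing A] [StarRing A] [CStarRing A] [CompleteSpace A]
    [NormedAlgebra ℂ A] [StarModule ℂ A] {H : Type*} [Group H]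
    (n : ℕ) (hn : 1 ≤ n) (p : ℕ → A)
    (hsa : ∀ i, 1 ≤ i → i ≤ n → star (p i) = p i ∧ p i * p i = p i)
    (hchain : ∀ i, 1 ≤ i → i < n →
      p i * p (i + 1) = p (i + 1) ∧ p (i + 1) * p i = p (i + 1))
    (hcomm : ∀ i, 1 ≤ i → i < n → ∀ x ∈ Dset (p i), p (i + 1) * x = x * p (i + 1))
    (hp0 : p (n + 1) = 0)
    (Hsub : ℕ → Subgroup H)
    (hHchain : ∀ i, 1 ≤ i → i < n → Hsub i ≤ Hsub (i + 1))
    (β : ℕ → H → A)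
    (hβmem : ∀ i, 1 ≤ i → i ≤ n → ∀ h ∈ Hsub i, β i h ∈ Dset (p i))
    (hβmul : ∀ i, 1 ≤ i → i ≤ n → ∀ h ∈ Hsub i, ∀ k ∈ Hsub i,
      β i (h * k) = β i h * β i k)
    (hβstep : ∀ i, 1 ≤ i → i < n → ∀ h ∈ Hsub i, β (i + 1) h = p (i + 1) * β i h) :
    ∀ k, 1 ≤ k → k ≤ n → ∀ h ∈ Hsub k,
      ∑ i ∈ Finset.Icc k n, (p i - p (i + 1)) * β i h * (p i - p (i + 1)) = β k h := by
  intro k hk hkn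
  induction hkn using Nat.decreasingInduction with
  | self =>
    intro h hh
    obtain ⟨hs, hp⟩ := hsa n hn le_rfl
    have hx := hβmem n hn le_rfl h hh
    simp [hp0, mul_eq_self_of_mem_Dset hs hp hx, mul_eq_self_of_mem_Dset' hs hp hx]
  | of_succ k hkn ih =>
    intro h hh
    obtain ⟨hs, hp⟩ := hsa k hk hkn.le
    have hx := hβmem k hk hkn.le h hh
    rw [← Finset.add_sum_Ioc_eq_sum_Icc hkn.le, ← Finset.Icc_add_one_left_eq_Ioc,
      ih (by lia) h (hHchain k hk hkn hh), hβstep k hk hkn h hh,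
      sub_mul_mul_sub_eq (mul_eq_self_of_mem_Dset hs hp hx) (mul_eq_self_of_mem_Dset' hs hp hx)
        (hsa (k + 1) (by lia) hkn).2 (hcomm k hk hkn _ hx), sub_add_cancel]
end

section
/- Let A be a C*-algebra, p₁, …, pₙ a compatible chain of self-adjoint idempotents in A, H a group, (H₁ ≤ … ≤ Hₙ, β₁, …, βₙ) a compatible system of homomorphisms for p₁, …, pₙ with fusion map γ : Hₙ → A, and let y₀ ∈ H and x₀ ∈ D_{p₁}. Put Eᵢ = y₀ Hᵢ and define αᵢ : Eᵢ → A by αᵢ(y) = x₀ * βᵢ(y₀⁻¹ y). Then (E₁ ⊆ … ⊆ Eₙ, α₁, …, αₙ) is a compatible system of affine maps for p₁, …, pₙ, and its fusion map α satisfies α(y) = x₀ * γ(y₀⁻¹ y) for all y ∈ Eₙ. -/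
namespace Dset

theorem star_mem {A : Type*} [Mul A] [InvolutiveStar A] {p x : A} (hx : x ∈ Dset p) :
    star x ∈ Dset p :=
  ⟨by rw [star_star]; exact hx.2, by rw [star_star]; exact hx.1⟩

section CStar

variable {A : Type*} [NormedRing A] [StarRing A] [CStarRing A] {p x e : A}

theorem mul_eq_self (hs : star p = p) (hp : p * p = p) (hx : x ∈ Dset p) : x * p = x := by
  have h : star (x - x * p) * (x - x * p) = 0 := by
    have hx' : star x * (x * p) = p := by rw [← mul_assoc, hx.1, hp]
    simp only [star_sub, star_mul, hs, sub_mul, mul_sub, mul_assoc, hx.1, hx', hp, sub_self]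
  exact (sub_eq_zero.mp ((CStarRing.star_mul_self_eq_zero_iff _).mp h)).symm

theorem self_mul_eq (hs : star p = p) (hp : p * p = p) (hx : x ∈ Dset p) : p * x = x := by
  simpa [hs] using congrArg star (mul_eq_self hs hp (star_mem hx))

theorem eq_of_idempotent (hs : star p = p) (hp : p * p = p) (he : e ∈ Dset p)
    (hee : e * e = e) : e = p := by
  calc e = p * e := (self_mul_eq hs hp he).symm
    _ = star e * (e * e) := by rw [← mul_assoc, he.1]
    _ = p := by rw [hee, he.1]

theorem map_inv_eq_star {H : Type*} [Group H] (hs : star p = p) (hp : p * p = p)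
    {K : Subgroup H} {f : H → A} (hf : ∀ h ∈ K, f h ∈ Dset p)
    (hmul : ∀ h ∈ K, ∀ k ∈ K, f (h * k) = f h * f k) {k : H} (hk : k ∈ K) :
    f k⁻¹ = star (f k) := by
  have h1 : f 1 = p := eq_of_idempotent hs hp (hf 1 K.one_mem)
    (by rw [← hmul 1 K.one_mem 1 K.one_mem, mul_one])
  have hinv : f k * f k⁻¹ = p := by rw [← hmul k hk _ (K.inv_mem hk), mul_inv_cancel, h1]
  calc f k⁻¹ = p * f k⁻¹ := (self_mul_eq hs hp (hf _ (K.inv_mem hk))).symm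
    _ = star (f k) * (f k * f k⁻¹) := by rw [← mul_assoc, (hf k hk).1]
    _ = star (f k) * p := by rw [hinv]
    _ = star (f k) := mul_eq_self hs hp (star_mem (hf k hk))

end CStar

section StarRing

variable {A : Type*} [Ring A] [StarRing A] {p q x y : A}

theorem cutdown_mem (hs : star q = q) (hq : q * q = q) (hpq : p * q = q)
    (hx : x ∈ Dset p) (hc : q * x = x * q) : q * x ∈ Dset q := by
  constructor
  · calc star (q * x) * (q * x) = q * (star x * x) * q := by
          rw [hc]; simp only [star_mul, hs, mul_assoc]
      _ = q := by rw [hx.1, mul_assoc, hpq, hq]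
  · calc q * x * star (q * x) = q * ((x * star x) * q) := by
          simp only [star_mul, hs, mul_assoc]
      _ = q := by rw [hx.2, hpq, hq]

theorem mul_mem (hx : x ∈ Dset p) (hy : y ∈ Dset p) (hyp : p * y = y) (hxp : x * p = x) :
    x * y ∈ Dset p := by
  constructor
  · rw [star_mul, mul_assoc, ← mul_assoc (star x), hx.1, hyp, hy.1]
  · rw [star_mul, mul_assoc, ← mul_assoc y, hy.2, ← mul_assoc, hxp, hx.2]

theorem chain_commute {n : ℕ} {p : ℕ → A}
    (hsa : ∀ i, 1 ≤ i → i ≤ n → star (p i) = p i ∧ p i * p i = p i)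
    (hchain : ∀ i, 1 ≤ i → i < n →
      p i * p (i + 1) = p (i + 1) ∧ p (i + 1) * p i = p (i + 1))
    (hcomm : ∀ i, 1 ≤ i → i < n → ∀ x ∈ Dset (p i), p (i + 1) * x = x * p (i + 1))
    {x : A} (hx : x ∈ Dset (p 1)) (hpx : p 1 * x = x) (hxp : x * p 1 = x) {i : ℕ}
    (hi : 1 ≤ i) (hin : i ≤ n) :
    p i * x = x * p i ∧ p i * x ∈ Dset (p i) ∧ p 1 * p i = p i := by
  induction i, hi using Nat.le_induction with
  | base => exact ⟨hpx.trans hxp.symm, by rwa [hpx], (hsa 1 le_rfl hin).2⟩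
  | succ i hi ih =>
    obtain ⟨hc, hm, h1⟩ := ih (by omega)
    obtain ⟨hr, hl⟩ := hchain i hi hin
    obtain ⟨hs, hq⟩ := hsa (i + 1) (by omega) hin
    have hd := hcomm i hi hin _ hm
    have hcut : p (i + 1) * (p i * x) = p (i + 1) * x := by rw [← mul_assoc, hl]
    refine ⟨?_, hcut ▸ cutdown_mem hs hq hr hm hd, by rw [← hr, ← mul_assoc, h1]⟩
    rw [← hcut, hd, hc, mul_assoc, hr]

end StarRing

end Dset

/-- From a compatible system of homomorphisms `(Hsub 1 ≤ ⋯ ≤ Hsub n, β 1, …, β n)` for a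
compatible chain `p 1, …, p n`, an element `y₀ ∈ H` and `x₀ ∈ D_{p 1}`, the cosets
`E i = y₀ (Hsub i)` together with the maps `α i y = x₀ * β i (y₀⁻¹ y)` form a compatible
system of affine maps for `p 1, …, p n`, whose fusion map `α` satisfies
`α y = x₀ * γ (y₀⁻¹ y)` where `γ` is the fusion map of the `β i`. -/
theorem stmt17 {A : Type*} [NormedRing A] [StarRing A] [CStarRing A] [CompleteSpace A]
    [NormedAlgebra ℂ A] [StarModule ℂ A] {H : Type*} [Group H]
    (n : ℕ) (hn : 1 ≤ n) (p : ℕ → A)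
    (hsa : ∀ i, 1 ≤ i → i ≤ n → star (p i) = p i ∧ p i * p i = p i)
    (hchain : ∀ i, 1 ≤ i → i < n →
      p i * p (i + 1) = p (i + 1) ∧ p (i + 1) * p i = p (i + 1))
    (hcomm : ∀ i, 1 ≤ i → i < n → ∀ x ∈ Dset (p i), p (i + 1) * x = x * p (i + 1))
    (Hsub : ℕ → Subgroup H)
    (hHchain : ∀ i, 1 ≤ i → i < n → Hsub i ≤ Hsub (i + 1))
    (β : ℕ → H → A)
    (hβmem : ∀ i, 1 ≤ i → i ≤ n → ∀ h ∈ Hsub i, β i h ∈ Dset (p i))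
    (hβmul : ∀ i, 1 ≤ i → i ≤ n → ∀ h ∈ Hsub i, ∀ k ∈ Hsub i,
      β i (h * k) = β i h * β i k)
    (hβstep : ∀ i, 1 ≤ i → i < n → ∀ h ∈ Hsub i, β (i + 1) h = p (i + 1) * β i h)
    (y₀ : H) (x₀ : A) (hx₀ : x₀ ∈ Dset (p 1))
    (E : ℕ → Set H) (hE : ∀ i, E i = {y : H | y₀⁻¹ * y ∈ Hsub i})
    (α : ℕ → H → A) (hα : ∀ i y, α i y = x₀ * β i (y₀⁻¹ * y)) :
    (∀ i, 1 ≤ i → i ≤ n → (E i).Nonempty) ∧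
    (∀ i, 1 ≤ i → i < n → E i ⊆ E (i + 1)) ∧
    (∀ i, 1 ≤ i → i ≤ n → ∀ x ∈ E i, ∀ y ∈ E i, ∀ z ∈ E i,
      x * y⁻¹ * z ∈ E i) ∧
    (∀ i, 1 ≤ i → i ≤ n → ∀ y ∈ E i, α i y ∈ Dset (p i)) ∧
    (∀ i, 1 ≤ i → i ≤ n → ∀ x ∈ E i, ∀ y ∈ E i, ∀ z ∈ E i,
      α i (x * y⁻¹ * z) = α i x * star (α i y) * α i z) ∧
    (∀ i, 1 ≤ i → i < n → ∀ y ∈ E i, α (i + 1) y = p (i + 1) * α i y) ∧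
    (∀ k, 1 ≤ k → k ≤ n → ∀ y ∈ E k, (k = 1 ∨ y ∉ E (k - 1)) →
      y₀⁻¹ * y ∈ Hsub k ∧ (k = 1 ∨ y₀⁻¹ * y ∉ Hsub (k - 1)) ∧
      α k y = x₀ * β k (y₀⁻¹ * y)) := by
  have hcl : ∀ i, ∀ x ∈ E i, ∀ y ∈ E i, ∀ z ∈ E i, x * y⁻¹ * z ∈ E i := by
    intro i x hx y hy z hz
    rw [hE, Set.mem_ofPred_eq] at *
    have h := (Hsub i).mul_mem ((Hsub i).mul_mem hx ((Hsub i).inv_mem hy)) hz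
    convert h using 1
    group
  obtain ⟨hs1, hp1⟩ := hsa 1 le_rfl hn
  have hchain_x₀ := fun i hi hin => Dset.chain_commute hsa hchain hcomm hx₀
    (Dset.self_mul_eq hs1 hp1 hx₀) (Dset.mul_eq_self hs1 hp1 hx₀) (i := i) hi hin
  have hpβ : ∀ i, 1 ≤ i → i ≤ n → ∀ h ∈ Hsub i, p i * β i h = β i h := fun i hi hin h hh =>
    Dset.self_mul_eq (hsa i hi hin).1 (hsa i hi hin).2 (hβmem i hi hin h hh)
  refine ⟨fun i _ _ => ⟨y₀, by simp [hE]⟩, fun i hi hin y hy => ?_,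
    fun i _ _ => hcl i, fun i hi hin y hy => ?_, fun i hi hin x hx y hy z hz => ?_,
    fun i hi hin y hy => ?_, fun k _ _ y hy hk => ?_⟩
  · rw [hE, Set.mem_ofPred_eq] at *
    exact hHchain i hi hin hy
  · rw [hE, Set.mem_ofPred_eq] at hy
    obtain ⟨hc, hm, -⟩ := hchain_x₀ i hi hin
    obtain ⟨hs, hp⟩ := hsa i hi hin
    have hβ := hpβ i hi hin _ hy
    have hα' : α i y = p i * x₀ * β i (y₀⁻¹ * y) := by rw [hα, hc, mul_assoc, hβ]
    rw [hα']
    exact Dset.mul_mem hm (hβmem i hi hin _ hy) hβ (Dset.mul_eq_self hs hp hm)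
  · rw [hE, Set.mem_ofPred_eq] at hx hy hz
    obtain ⟨hs, hp⟩ := hsa i hi hin
    have hp1β : p 1 * β i (y₀⁻¹ * z) = β i (y₀⁻¹ * z) := by
      rw [← hpβ i hi hin _ hz, ← mul_assoc, (hchain_x₀ i hi hin).2.2]
    have hgrp : y₀⁻¹ * (x * y⁻¹ * z) = y₀⁻¹ * x * (y₀⁻¹ * y)⁻¹ * (y₀⁻¹ * z) := by group
    have hinv := (Hsub i).inv_mem hy
    rw [hα, hα, hα, hα, hgrp, hβmul i hi hin _ ((Hsub i).mul_mem hx hinv) _ hz,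
      hβmul i hi hin _ hx _ hinv,
      Dset.map_inv_eq_star hs hp (hβmem i hi hin) (hβmul i hi hin) hy, star_mul]
    simp only [mul_assoc]
    rw [← mul_assoc (star x₀), hx₀.1, hp1β]
  · rw [hE, Set.mem_ofPred_eq] at hy
    rw [hα, hα, hβstep i hi hin _ hy, ← mul_assoc, ← mul_assoc,
      (hchain_x₀ (i + 1) (by omega) hin).1]
  · simp only [hE, Set.mem_ofPred_eq] at hy hk
    exact ⟨hy, hk, hα k y⟩
end
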